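/- Let A be an Artin algebra and D ⊆ mod A a 0-Igusa-Todorov subcategory. If rad^{2n+1}(A) = 0 and the set of isomorphism classes of indecomposable A/rad^n(A)-modules not lying in D (viewed inside mod A) is finite, then A is a 1-LIT algebra. -/

import Mathlib

/-!
Common framework for formalizing "On Lat-Igusa-Todorov algebras" (Barrios–Mata).

For a ring `S`, `FGMod S` is the "category" of finitely generated (left) `S`-modules;
for an Artin algebra `A`, the category `mod A` of finitely generated *right*
`A`-modules is `FGMod Aᵐᵒᵖ`.
-/

universe u v

open Function

namespace LIT

/-- The `η` invariant from Fitting's Lemma: for an endomorphism `L` of an abelian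
group `G` and a subgroup `X`, the least `k` such that for all `m ≥ k` the
restriction of `L` to `L^m(X)` is a monomorphism `L^m(X) → L^{m+1}(X)`. -/
noncomputable def eta {G : Type v} [AddCommGroup G] (L : AddMonoid.End G)
    (X : AddSubgroup G) : ℕ :=
  sInf {k : ℕ | ∀ m : ℕ, k ≤ m → Set.InjOn L (X.map (L ^ m) : Set G)}

/-- Bundled finitely generated `S`-modules. -/
structure FGMod (S : Type u) [Ring S] : Type (u + 1) where
  carrier : Type u
  [isAddCommGroup : AddCommGroup carrier]
  [isModule : Module S carrier]
  [isFinite : Module.Finite S carrier]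

attribute [instance] FGMod.isAddCommGroup FGMod.isModule FGMod.isFinite

/-- The regular module `S` over itself. -/
def FGMod.regular (S : Type u) [Ring S] : FGMod S := ⟨S⟩

/-- A ring is finitely generated as a right module over itself. -/
instance (A : Type u) [Ring A] : Module.Finite Aᵐᵒᵖ A :=
  Module.Finite.of_surjective
    ({ toFun := MulOpposite.unop
       map_add' := fun _ _ => rfl
       map_smul' := fun _ _ => rfl } : Aᵐᵒᵖ →ₗ[Aᵐᵒᵖ] A)
    (fun x => ⟨MulOpposite.op x, rfl⟩)

namespace FGMod

variable {S : Type u} [Ring S]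

/-- Projectivity of a module. -/
def IsProj (M : FGMod S) : Prop := Module.Projective S M.carrier

/-- Direct sum (product) of two modules. -/
def prodMod (M N : FGMod S) : FGMod S := ⟨M.carrier × N.carrier⟩

/-- Finite direct sums. -/
def dsum {n : ℕ} (f : Fin n → FGMod S) : FGMod S := ⟨∀ i, (f i).carrier⟩

/-- `N` is a direct summand of `M`. -/
def IsSummand (N M : FGMod S) : Prop :=
  ∃ N' : FGMod S, Nonempty (M.carrier ≃ₗ[S] N.carrier × N'.carrier)

/-- `addOf C` is `add C`: all direct summands of finite direct sums of modules of `C`. -/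
def addOf (C : Set (FGMod S)) : Set (FGMod S) :=
  {N | ∃ (n : ℕ) (f : Fin n → FGMod S), (∀ i, f i ∈ C) ∧ IsSummand N (dsum f)}

/-- `f : P → M` is a projective cover: `P` projective, `f` surjective with superfluous kernel. -/
def IsProjCover {P M : FGMod S} (f : P.carrier →ₗ[S] M.carrier) : Prop :=
  P.IsProj ∧ Surjective f ∧
    ∀ N : Submodule S P.carrier, N ⊔ LinearMap.ker f = ⊤ → N = ⊤

/-- `N` is (isomorphic to) the syzygy `Ω(M)`, i.e. the kernel of a projective cover of `M`. -/
def IsSyzygyOf (N M : FGMod S) : Prop :=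
  ∃ (P : FGMod S) (f : P.carrier →ₗ[S] M.carrier),
    IsProjCover f ∧ Nonempty (N.carrier ≃ₗ[S] LinearMap.ker f)

/-- The syzygy `Ω(M)` of `M` (a choice of it; over an Artin algebra it exists and is
unique up to isomorphism). -/
noncomputable def syz (M : FGMod S) : FGMod S :=
  letI := Classical.propDecidable (∃ N, IsSyzygyOf N M)
  if h : ∃ N, IsSyzygyOf N M then h.choose else M

/-- `SES X Y Z` : there is a short exact sequence `0 → X → Y → Z → 0`. -/
def SES (X Y Z : FGMod S) : Prop :=
  ∃ (f : X.carrier →ₗ[S] Y.carrier) (g : Y.carrier →ₗ[S] Z.carrier),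
    Injective f ∧ Surjective g ∧ LinearMap.range f = LinearMap.ker g

/-- Projective dimension, via vanishing of syzygies. -/
noncomputable def pdim (M : FGMod S) : ℕ∞ :=
  sInf ((↑) '' {n : ℕ | (syz^[n] M).IsProj})

end FGMod

open FGMod

variable {S : Type u} [Ring S]

/-- The finitistic dimension of a class of modules: the supremum of the projective
dimensions of its modules of finite projective dimension. -/
noncomputable def findim (C : Set (FGMod S)) : ℕ∞ :=
  ⨆ M ∈ {M ∈ C | pdim M ≠ ⊤}, pdim M

/-- The global dimension of a class of modules. -/
noncomputable def gldim (C : Set (FGMod S)) : ℕ∞ :=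
  ⨆ M ∈ C, pdim M

/-- The defining relations of `K₀`: `[M] - [M'] - [M'']` for `M ≅ M' ⊕ M''`, and `[P]`
for `P` projective. -/
def K0Rels (S : Type u) [Ring S] : AddSubgroup (FreeAbelianGroup (FGMod S)) :=
  AddSubgroup.closure
    ({x | ∃ M M' M'' : FGMod S,
        Nonempty (M.carrier ≃ₗ[S] M'.carrier × M''.carrier) ∧
        x = FreeAbelianGroup.of M - FreeAbelianGroup.of M' - FreeAbelianGroup.of M''} ∪
      {x | ∃ P : FGMod S, P.IsProj ∧ x = FreeAbelianGroup.of P})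

/-- `K₀(A)`: the free abelian group on the modules modulo the relations above. -/
abbrev K0 (S : Type u) [Ring S] : Type (u + 1) :=
  FreeAbelianGroup (FGMod S) ⧸ K0Rels S

/-- The class `[M]` of a module in `K₀`. -/
def toK0 (M : FGMod S) : K0 S := QuotientAddGroup.mk (FreeAbelianGroup.of M)

/-- `⟨C⟩`: the subgroup of `K₀` generated by the classes of direct summands of
modules of `C`. -/
def grpOf (C : Set (FGMod S)) : AddSubgroup (K0 S) :=
  AddSubgroup.closure {x | ∃ N M : FGMod S, M ∈ C ∧ IsSummand N M ∧ x = toK0 N}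

/-- `K_D = K₀/⟨D⟩`. -/
abbrev KD (D : Set (FGMod S)) : Type (u + 1) := K0 S ⧸ grpOf D

/-- The class of a module in `K_D`. -/
def toKD (D : Set (FGMod S)) (M : FGMod S) : KD D :=
  QuotientAddGroup.mk (toK0 M)

/-- `L` is the endomorphism `Ω̄` of `K₀` induced by the syzygy operator (it is unique). -/
def IsSyzEnd (L : AddMonoid.End (K0 S)) : Prop :=
  ∀ M : FGMod S, L (toK0 M) = toK0 (syz M)

/-- `L` is the endomorphism `Ω̄_D` of `K_D` induced by the syzygy operator. -/
def IsSyzEndD (D : Set (FGMod S)) (L : AddMonoid.End (KD D)) : Prop :=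
  ∀ M : FGMod S, L (toKD D M) = toKD D (syz M)

/-- The Igusa–Todorov function `φ`, relative to the induced endomorphism `L = Ω̄` of `K₀`. -/
noncomputable def phi (L : AddMonoid.End (K0 S)) (M : FGMod S) : ℕ :=
  eta L (grpOf {M})

/-- `φ`-dimension of a class of modules. -/
noncomputable def phidim (L : AddMonoid.End (K0 S)) (C : Set (FGMod S)) : ℕ∞ :=
  ⨆ M ∈ C, (phi L M : ℕ∞)

/-- The generalized Igusa–Todorov function `φ_[D]`, relative to `L = Ω̄_D`. -/
noncomputable def phiD (D : Set (FGMod S)) (L : AddMonoid.End (KD D)) (M : FGMod S) : ℕ :=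
  eta L ((grpOf {M}).map (QuotientAddGroup.mk' (grpOf D)))

/-- The generalized Igusa–Todorov function `ψ_[D]`. -/
noncomputable def psiD (D : Set (FGMod S)) (L : AddMonoid.End (KD D)) (M : FGMod S) : ℕ∞ :=
  (phiD D L M : ℕ∞) + findim (addOf {syz^[phiD D L M] M})

/-- `D` is a `0`-Igusa–Todorov subcategory: `D = add D`, `Ω(D) ⊆ D` and `φdim D = 0`. -/
def IsZeroIT (L : AddMonoid.End (K0 S)) (D : Set (FGMod S)) : Prop :=
  D = addOf D ∧ (∀ M ∈ D, syz M ∈ D) ∧ phidim L D = 0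

/-- The class `C` is `(n,V,D)`-Lat-Igusa-Todorov: every `M ∈ C` admits an exact sequence
`0 → V₁ ⊕ D₁ → V₀ ⊕ D₀ → Ωⁿ(M) → 0` with `V₁, V₀ ∈ add V` and `D₁, D₀ ∈ D`. -/
def IsLITClass (n : ℕ) (V : FGMod S) (D : Set (FGMod S)) (C : Set (FGMod S)) : Prop :=
  ∀ M ∈ C, ∃ V1 V0 D1 D0 : FGMod S,
    V1 ∈ addOf {V} ∧ V0 ∈ addOf {V} ∧ D1 ∈ D ∧ D0 ∈ D ∧
    SES (prodMod V1 D1) (prodMod V0 D0) (syz^[n] M)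

/-- `[C]_D`: the image of `⟨C⟩` in `K_D`, i.e. `(⟨C⟩ + ⟨D⟩)/⟨D⟩`. -/
def classGrpD (D C : Set (FGMod S)) : AddSubgroup (KD D) :=
  (grpOf C).map (QuotientAddGroup.mk' (grpOf D))

/-- `C` is `D`-syzygy finite: `[Ω^k(C)]_D` is finitely generated for some `k`. -/
def DSyzFinite (D C : Set (FGMod S)) : Prop :=
  ∃ k : ℕ, (classGrpD D ((fun M => syz^[k] M) '' C)).FG

/-- The algebra is `n`-LIT: there are a `0`-Igusa–Todorov subcategory `D` and a module `V`
such that `mod A` is `(n,V,D)`-LIT. -/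
def IsNLITAlgebra (L : AddMonoid.End (K0 S)) (n : ℕ) : Prop :=
  ∃ (V : FGMod S) (D : Set (FGMod S)), IsZeroIT L D ∧ IsLITClass n V D Set.univ

/-- The algebra is LIT: it is `n`-LIT for some `n`. -/
def IsLITAlgebra (L : AddMonoid.End (K0 S)) : Prop :=
  ∃ n : ℕ, IsNLITAlgebra L n


/-! Indecomposable modules, finiteness up to isomorphism, and modules over quotient
algebras viewed inside `mod A`. -/

/-- `M` is indecomposable: nonzero, and any direct sum decomposition is trivial. -/
def Indec {S : Type u} [Ring S] (M : FGMod S) : Prop :=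
  ¬ Subsingleton M.carrier ∧
    ∀ N N' : FGMod S, Nonempty (M.carrier ≃ₗ[S] N.carrier × N'.carrier) →
      Subsingleton N.carrier ∨ Subsingleton N'.carrier

/-- A class of modules contains only finitely many isomorphism classes. -/
def FinUpToIso {S : Type u} [Ring S] (C : Set (FGMod S)) : Prop :=
  ∃ (n : ℕ) (f : Fin n → FGMod S),
    ∀ M ∈ C, ∃ i, Nonempty (M.carrier ≃ₗ[S] (f i).carrier)

/-- The right `A`-modules annihilated by a (two-sided) ideal `I`, i.e. the image of
`mod (A/I)` inside `mod A`. -/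
def annClass {A : Type u} [Ring A] (I : Submodule Aᵐᵒᵖ A) : Set (FGMod Aᵐᵒᵖ) :=
  {M | ∀ (m : M.carrier), ∀ a ∈ I, MulOpposite.op a • m = 0}

/-- The right `A`-module `A/I`. -/
def qmod {A : Type u} [Ring A] (I : Submodule Aᵐᵒᵖ A) : FGMod Aᵐᵒᵖ := ⟨A ⧸ I⟩

/-! Direct summands and the closure `add`. -/

theorem isSummand_iff_exists_split [IsNoetherianRing S] {N M : FGMod S} :
    IsSummand N M ↔ ∃ (p : M.carrier →ₗ[S] N.carrier) (i : N.carrier →ₗ[S] M.carrier),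
      p ∘ₗ i = LinearMap.id := by
  constructor
  · rintro ⟨N', ⟨e⟩⟩
    exact ⟨LinearMap.fst S _ _ ∘ₗ e.toLinearMap, e.symm.toLinearMap ∘ₗ LinearMap.inl S _ _,
      by ext x; simp⟩
  · rintro ⟨p, i, h⟩
    have h' : ∀ x, p (i x) = x := fun x => LinearMap.congr_fun h x
    refine ⟨⟨LinearMap.ker p⟩, ⟨LinearEquiv.ofLinearMap
      (p.prod ((LinearMap.id - i ∘ₗ p).codRestrict _ fun x => by simp [h']))
      (i.coprod (LinearMap.ker p).subtype) ?_ ?_⟩⟩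
    · ext x <;> simp [h']
    · ext x; simp

theorem isSummand_trans [IsNoetherianRing S] {K N M : FGMod S} (h₁ : IsSummand K N)
    (h₂ : IsSummand N M) : IsSummand K M := by
  rw [isSummand_iff_exists_split] at *
  obtain ⟨p, i, h⟩ := h₁
  obtain ⟨q, j, h'⟩ := h₂
  refine ⟨p ∘ₗ q, j ∘ₗ i, LinearMap.ext fun x => ?_⟩
  exact (congrArg p (LinearMap.congr_fun h' (i x))).trans (LinearMap.congr_fun h x)

theorem isSummand_of_equiv {N M : FGMod S} (e : M.carrier ≃ₗ[S] N.carrier) : IsSummand N M :=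
  ⟨⟨PUnit⟩, ⟨e.trans (LinearEquiv.prodUnique (M₂ := PUnit.{u + 1})).symm⟩⟩

theorem isSummand_prodMod_left (M N : FGMod S) : IsSummand M (prodMod M N) :=
  ⟨N, ⟨LinearEquiv.refl S _⟩⟩

theorem isSummand_prodMod_right (M N : FGMod S) : IsSummand N (prodMod M N) :=
  ⟨M, ⟨LinearEquiv.prodComm S _ _⟩⟩

theorem isSummand_dsum [IsNoetherianRing S] {k : ℕ} (f : Fin k → FGMod S) (i : Fin k) :
    IsSummand (f i) (dsum f) :=
  isSummand_iff_exists_split.mpr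
    ⟨LinearMap.proj i, LinearMap.single S (fun j => (f j).carrier) i,
      LinearMap.ext fun x => Pi.single_eq_same (M := fun j => (f j).carrier) i x⟩

theorem mem_addOf_of_isSummand [IsNoetherianRing S] {C : Set (FGMod S)} {N M : FGMod S}
    (h : IsSummand N M) (hM : M ∈ addOf C) : N ∈ addOf C := by
  obtain ⟨k, f, hf, hs⟩ := hM
  exact ⟨k, f, hf, isSummand_trans h hs⟩

theorem mem_addOf_of_equiv [IsNoetherianRing S] {C : Set (FGMod S)} {N M : FGMod S}
    (e : M.carrier ≃ₗ[S] N.carrier) (hM : M ∈ addOf C) : N ∈ addOf C :=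
  mem_addOf_of_isSummand (isSummand_of_equiv e) hM

theorem subset_addOf (C : Set (FGMod S)) : C ⊆ addOf C := fun M hM =>
  ⟨1, fun _ => M, fun _ => hM,
    isSummand_of_equiv (LinearEquiv.funUnique (Fin 1) S M.carrier)⟩

theorem mem_addOf_of_subsingleton (C : Set (FGMod S)) {M : FGMod S} (h : Subsingleton M.carrier) :
    M ∈ addOf C := by
  refine ⟨0, fun i => i.elim0, fun i => i.elim0, isSummand_of_equiv ?_⟩
  have : Subsingleton (dsum fun i : Fin 0 => (i.elim0 : FGMod S)).carrier :=
    inferInstanceAs (Subsingleton (∀ i : Fin 0, (i.elim0 : FGMod S).carrier))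
  exact 0

theorem prodMod_mem_addOf [IsNoetherianRing S] {C : Set (FGMod S)} {M N : FGMod S}
    (hM : M ∈ addOf C) (hN : N ∈ addOf C) : prodMod M N ∈ addOf C := by
  obtain ⟨k, f, hf, M', ⟨e⟩⟩ := hM
  obtain ⟨l, g, hg, N', ⟨e'⟩⟩ := hN
  refine ⟨k + l, fun i => Sum.elim f g (finSumFinEquiv.symm i), fun i => ?_,
    ⟨prodMod M' N', ⟨?_⟩⟩⟩
  · change Sum.elim f g (finSumFinEquiv.symm i) ∈ C
    rcases finSumFinEquiv.symm i with j | j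
    exacts [hf j, hg j]
  · exact (LinearEquiv.piCongrLeft S (fun s => (Sum.elim f g s).carrier) finSumFinEquiv.symm).trans
      ((LinearEquiv.sumPiEquivProdPi S _ _ _).trans
        ((LinearEquiv.prodCongr e e').trans (LinearEquiv.prodProdProdComm S _ _ _ _)))

theorem dsum_mem_addOf [IsNoetherianRing S] {C : Set (FGMod S)} {k : ℕ} (f : Fin k → FGMod S)
    (hf : ∀ i, f i ∈ addOf C) : dsum f ∈ addOf C := by
  induction k with
  | zero =>
    exact mem_addOf_of_subsingleton C (inferInstanceAs (Subsingleton (∀ i : Fin 0, (f i).carrier)))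
  | succ k ih =>
    exact mem_addOf_of_equiv (Fin.consLinearEquiv S fun i => (f i).carrier)
      (prodMod_mem_addOf (hf 0) (ih (fun i => f i.succ) fun i => hf _))

theorem mem_addOf_of_isProj [IsNoetherianRing S] {C : Set (FGMod S)} {P : FGMod S}
    (hP : P.IsProj) (hC : FGMod.regular S ∈ addOf C) : P ∈ addOf C := by
  have : Module.Projective S P.carrier := hP
  obtain ⟨k, p, i, -, -, h⟩ := Module.Finite.exists_comp_eq_id_of_projective S P.carrier
  exact mem_addOf_of_isSummand (M := dsum fun _ : Fin k => FGMod.regular S)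
    (isSummand_iff_exists_split.mpr ⟨p, i, h⟩) (dsum_mem_addOf _ fun _ => hC)

/-! Projective covers and syzygies over an Artinian ring. -/

theorem exists_isProjCover_of_surjective [IsArtinianRing S] [IsNoetherianRing S] {M : FGMod S}
    (P : FGMod S) (hP : P.IsProj) (f : P.carrier →ₗ[S] M.carrier) (hf : Surjective f) :
    ∃ (Q : FGMod S) (g : Q.carrier →ₗ[S] M.carrier), IsProjCover g := by
  induction hl : Module.length S P.carrier using WellFoundedLT.induction generalizing P with
  | _ l ih =>
  subst hl
  by_cases hc : ∀ N : Submodule S P.carrier, N ⊔ LinearMap.ker f = ⊤ → N = ⊤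
  · exact ⟨P, f, hP, hf, hc⟩
  push Not at hc
  obtain ⟨N, hN, hNt⟩ := hc
  have : Module.Projective S P.carrier := hP
  have hsurj : Surjective (f ∘ₗ N.subtype) := fun m => by
    obtain ⟨x, rfl⟩ := hf m
    obtain ⟨y, hy, z, hz, rfl⟩ := Submodule.mem_sup.mp (hN ▸ Submodule.mem_top (x := x))
    exact ⟨⟨y, hy⟩, by simp [LinearMap.mem_ker.mp hz]⟩
  obtain ⟨h, hh⟩ := Module.projective_lifting_property _ f hsurj
  let t : Module.End S P.carrier := N.subtype ∘ₗ h
  have ft : ∀ x, f (t x) = f x := fun x => LinearMap.congr_fun hh x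
  have ftk : ∀ (k : ℕ) x, f ((t ^ k) x) = f x := by
    intro k
    induction k with
    | zero => simp
    | succ k ihk => intro x; rw [pow_succ', Module.End.mul_apply, ft, ihk]
  obtain ⟨k, hk, hk1⟩ := (t.eventually_isCompl_ker_pow_range_pow.and
    (Filter.eventually_ge_atTop 1)).exists
  have hlt : LinearMap.range (t ^ k) ≠ ⊤ := by
    intro htop
    refine hNt (top_le_iff.mp (htop.symm.le.trans ?_))
    rintro _ ⟨x, rfl⟩
    obtain ⟨j, rfl⟩ := Nat.exists_eq_add_of_le' hk1
    rw [pow_succ', Module.End.mul_apply]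
    exact (h _).2
  refine ih _ (Submodule.length_lt hlt) ⟨LinearMap.range (t ^ k)⟩ ?_
    (f ∘ₗ (LinearMap.range (t ^ k)).subtype) ?_ rfl
  · exact Module.Projective.of_split (LinearMap.range (t ^ k)).subtype
      (Submodule.projectionOnto _ _ hk.symm)
      (LinearMap.ext fun x => Submodule.projectionOnto_apply_left hk.symm x)
  · intro m
    obtain ⟨x, rfl⟩ := hf m
    exact ⟨⟨(t ^ k) x, x, rfl⟩, ftk k x⟩

theorem exists_isProjCover [IsArtinianRing S] [IsNoetherianRing S] (M : FGMod S) :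
    ∃ (P : FGMod S) (f : P.carrier →ₗ[S] M.carrier), IsProjCover f := by
  obtain ⟨k, f, hf⟩ := Module.Finite.exists_fin' S M.carrier
  exact exists_isProjCover_of_surjective (dsum fun _ : Fin k => FGMod.regular S)
    (inferInstanceAs (Module.Projective S (Fin k → S))) f hf

theorem isSyzygyOf_syz [IsArtinianRing S] [IsNoetherianRing S] (M : FGMod S) :
    IsSyzygyOf (syz M) M := by
  obtain ⟨P, f, hf⟩ := exists_isProjCover M
  have h : ∃ N, IsSyzygyOf N M := ⟨⟨LinearMap.ker f⟩, P, f, hf, ⟨LinearEquiv.refl S _⟩⟩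
  rw [syz, dif_pos h]
  exact h.choose_spec

theorem ker_le_jacobson_of_isProjCover {P M : FGMod S} {f : P.carrier →ₗ[S] M.carrier}
    (hf : IsProjCover f) : LinearMap.ker f ≤ Module.jacobson S P.carrier := by
  refine le_sInf fun m hm => ?_
  by_contra hle
  refine hm.1 (hf.2.2 m (hm.2 _ (lt_of_le_of_ne le_sup_left fun he => hle ?_)))
  rw [he]
  exact le_sup_right

/-- The kernel of a projective cover is separated by functionals with values in the radical. -/
theorem syz_exists_embedding [IsArtinianRing S] [IsNoetherianRing S] (M : FGMod S) :
    ∃ (k : ℕ) (i : (syz M).carrier →ₗ[S] (Fin k → S)), Injective i ∧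
      ∀ x j, i x j ∈ Ring.jacobson S := by
  obtain ⟨P, f, hf, ⟨e⟩⟩ := isSyzygyOf_syz M
  have : Module.Projective S P.carrier := hf.1
  obtain ⟨k, p, i, -, hi, -⟩ := Module.Finite.exists_comp_eq_id_of_projective S P.carrier
  refine ⟨k, i ∘ₗ (LinearMap.ker f).subtype ∘ₗ e.toLinearMap,
    hi.comp (Subtype.val_injective.comp e.injective), fun x j => ?_⟩
  exact Module.le_comap_jacobson (LinearMap.proj j ∘ₗ i) (ker_le_jacobson_of_isProjCover hf (e x).2)

/-! Decomposition into indecomposables. -/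

theorem induction_on_indec [IsArtinianRing S] [IsNoetherianRing S] (C : Set (FGMod S))
    (hC : ∀ W N : FGMod S, IsSummand N W → W ∈ C → N ∈ C) (Q : FGMod S → Prop)
    (hzero : ∀ W : FGMod S, Subsingleton W.carrier → Q W)
    (hindec : ∀ W ∈ C, Indec W → Q W)
    (hprod : ∀ W N N' : FGMod S, Nonempty (W.carrier ≃ₗ[S] N.carrier × N'.carrier) →
      Q N → Q N' → Q W) : ∀ W ∈ C, Q W := by
  intro W hW
  induction hl : Module.length S W.carrier using WellFoundedLT.induction generalizing W with
  | _ l ih =>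
  subst hl
  by_cases hs : Subsingleton W.carrier
  · exact hzero W hs
  by_cases hi : Indec W
  · exact hindec W hW hi
  have : ∃ N N' : FGMod S, Nonempty (W.carrier ≃ₗ[S] N.carrier × N'.carrier) ∧
      ¬ Subsingleton N.carrier ∧ ¬ Subsingleton N'.carrier := by
    by_contra hcon
    push Not at hcon
    exact hi ⟨hs, fun N N' e => by
      by_cases hN : Subsingleton N.carrier
      · exact .inl hN
      · exact .inr (not_nontrivial_iff_subsingleton.mp fun h => by
          have := hcon N N' e (not_subsingleton_iff_nontrivial.mp hN)
          exact not_subsingleton N'.carrier this)⟩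
  obtain ⟨N, N', ⟨e⟩, hN, hN'⟩ := this
  rw [not_subsingleton_iff_nontrivial] at hN hN'
  have hlen := e.length_eq.trans (Module.length_prod S N.carrier N'.carrier)
  have hNtop : Module.length S N.carrier ≠ ⊤ := Module.length_ne_top
  have hNtop' : Module.length S N'.carrier ≠ ⊤ := Module.length_ne_top
  refine hprod W N N' ⟨e⟩ (ih _ ?_ N (hC W N ⟨N', ⟨e⟩⟩ hW) rfl)
    (ih _ ?_ N' (hC W N' ⟨N, ⟨e.trans (LinearEquiv.prodComm S _ _)⟩⟩ hW) rfl)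
  · rw [hlen]
    exact add_comm (Module.length S N.carrier) _ ▸ ENat.lt_add_left hNtop Module.length_pos
  · rw [hlen]
    exact ENat.lt_add_left hNtop' Module.length_pos

/-! Short exact sequences. -/

theorem SES_congr {X X' Y Y' Z : FGMod S} (h : SES X Y Z) (e : X.carrier ≃ₗ[S] X'.carrier)
    (e' : Y.carrier ≃ₗ[S] Y'.carrier) : SES X' Y' Z := by
  obtain ⟨f, g, hf, hg, hfg⟩ := h
  refine ⟨e'.toLinearMap ∘ₗ f ∘ₗ e.symm.toLinearMap, g ∘ₗ e'.symm.toLinearMap,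
    e'.injective.comp (hf.comp e.symm.injective), hg.comp e'.symm.surjective, ?_⟩
  ext y
  constructor
  · rintro ⟨x, rfl⟩
    have : f (e.symm x) ∈ LinearMap.ker g := hfg ▸ ⟨_, rfl⟩
    simpa using this
  · intro hy
    have hy' : e'.symm y ∈ LinearMap.range f := hfg ▸ hy
    obtain ⟨x, hx⟩ := hy'
    exact ⟨e x, by simp [hx]⟩

/-- A projective presentation of `X / Y` lifts to a presentation of `X` by `P ⊕ Y`. -/
theorem SES_of_cover_quotient [IsNoetherianRing S] {X P : FGMod S} (Y : Submodule S X.carrier)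
    (hP : P.IsProj) (p : P.carrier →ₗ[S] X.carrier ⧸ Y) (hp : Surjective p) :
    SES ⟨LinearMap.ker p⟩ (prodMod P ⟨Y⟩) X := by
  have : Module.Projective S P.carrier := hP
  obtain ⟨q, hq⟩ := Module.projective_lifting_property Y.mkQ p Y.mkQ_surjective
  have hq' : ∀ x, Y.mkQ (q x) = p x := fun x => LinearMap.congr_fun hq x
  have hmem : ∀ x, q x ∈ Y ↔ p x = 0 := fun x => by
    rw [← hq', Submodule.mkQ_apply, Submodule.Quotient.mk_eq_zero]
  refine ⟨(LinearMap.ker p).subtype.prod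
    (-(q ∘ₗ (LinearMap.ker p).subtype).codRestrict Y fun x => (hmem x).mpr x.2),
    q.coprod Y.subtype, fun x y hxy => Subtype.ext (congrArg Prod.fst hxy), fun x => ?_, ?_⟩
  · obtain ⟨y, hy⟩ := hp (Y.mkQ x)
    have hxy : x - q y ∈ Y := by
      rw [← Submodule.Quotient.mk_eq_zero, ← Submodule.mkQ_apply, map_sub, hq', hy, sub_self]
    exact ⟨(y, ⟨x - q y, hxy⟩), add_sub_cancel (q y) x⟩
  · ext ⟨x, y⟩
    constructor
    · rintro ⟨⟨z, hz⟩, hzxy⟩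
      rw [← hzxy]
      exact add_neg_cancel (q z)
    · intro h
      have h0 : q x + (y : X.carrier) = 0 := h
      have hy : q x = -(y : X.carrier) := eq_neg_of_add_eq_zero_left h0
      refine ⟨⟨x, (hmem x).mp (hy ▸ Y.neg_mem y.2)⟩, Prod.ext rfl (Subtype.ext ?_)⟩
      exact neg_eq_of_add_eq_zero_right h0

/-! The Jacobson radical of the opposite ring. -/

theorem unop_mem_jacobson {A : Type u} [Ring A] {x : Aᵐᵒᵖ} (hx : x ∈ Ring.jacobson Aᵐᵒᵖ) :
    x.unop ∈ Ideal.jacobson (⊥ : Ideal A) := by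
  rw [← Ideal.jacobson_bot, Ideal.mem_jacobson_iff] at hx
  have hr : ∀ y : A, ∃ z : A, (1 + x.unop * y) * z = 1 := fun y => by
    obtain ⟨z, hz⟩ := hx (MulOpposite.op y)
    have h := congrArg MulOpposite.unop ((Submodule.mem_bot _).mp hz)
    simp only [MulOpposite.unop_sub, MulOpposite.unop_add, MulOpposite.unop_mul,
      MulOpposite.unop_op, MulOpposite.unop_one, MulOpposite.unop_zero] at h
    exact ⟨z.unop, by rw [← sub_eq_zero, ← h]; noncomm_ring⟩
  rw [Ideal.mem_jacobson_iff]
  intro y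
  obtain ⟨z, hz⟩ := hr y
  obtain ⟨w, hw⟩ := hr (-(y * z))
  have hz' : 1 + x.unop * -(y * z) = z := calc
    1 + x.unop * -(y * z) = (1 + x.unop * y) * z + x.unop * -(y * z) := by rw [hz]
    _ = z := by noncomm_ring
  rw [hz'] at hw
  have hzl : z * (1 + x.unop * y) = 1 := by
    rw [← left_inv_eq_right_inv hz hw] at hw
    exact hw
  refine ⟨1 - y * z * x.unop, (Submodule.mem_bot _).mpr ?_⟩
  have : (1 - y * z * x.unop) * y * x.unop + (1 - y * z * x.unop) - 1 =
      y * (1 - z * (1 + x.unop * y)) * x.unop := by noncomm_ring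
  rw [this, hzl]
  simp

/-- Syzygies over an algebra with `rad ^ (2 * n + 1) = 0` are killed by `radⁿ A radⁿ`. -/
theorem smul_syz_eq_zero {R A : Type u} [CommRing R] [Ring A] [Algebra R A]
    [IsArtinianRing Aᵐᵒᵖ] [IsNoetherianRing Aᵐᵒᵖ] {n : ℕ}
    (hrad : ((Ideal.jacobson (⊥ : Ideal A)).restrictScalars R) ^ (2 * n + 1) =
      (⊥ : Submodule R A)) (M : FGMod Aᵐᵒᵖ) (x : (syz M).carrier) {a b : A} (s : A)
    (ha : a ∈ ((Ideal.jacobson (⊥ : Ideal A)).restrictScalars R) ^ n)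
    (hb : b ∈ ((Ideal.jacobson (⊥ : Ideal A)).restrictScalars R) ^ n) :
    MulOpposite.op b • MulOpposite.op s • MulOpposite.op a • x = 0 := by
  obtain ⟨k, i, hi, hJ⟩ := syz_exists_embedding M
  apply hi
  rw [map_zero]
  ext j
  have hc := unop_mem_jacobson (hJ x j)
  set J : Submodule R A := (Ideal.jacobson (⊥ : Ideal A)).restrictScalars R with hJdef
  have hca : (i x j).unop * a ∈ J ^ (n + 1) := by
    rw [pow_succ']
    exact Submodule.mul_mem_mul hc ha
  have hright : ∀ y ∈ J ^ (n + 1), y * s ∈ J ^ (n + 1) := by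
    intro y hy
    rw [pow_succ] at hy ⊢
    induction hy using Submodule.mul_induction_on' with
    | mem_mul_mem u hu v hv =>
      rw [mul_assoc]
      exact Submodule.mul_mem_mul hu (Ideal.mul_mem_right s _ (show v ∈ Ideal.jacobson ⊥ from hv))
    | add u _ v _ hu hv =>
      rw [add_mul]
      exact add_mem hu hv
  have hmem : (i x j).unop * a * s * b ∈ J ^ (2 * n + 1) := by
    rw [show 2 * n + 1 = (n + 1) + n by ring, pow_add]
    exact Submodule.mul_mem_mul (hright _ hca) hb
  rw [hrad, Submodule.mem_bot] at hmem
  simp only [map_smul, Pi.smul_apply, smul_eq_mul, Pi.zero_apply]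
  apply MulOpposite.unop_injective
  simpa [mul_assoc] using hmem

/-! Relative presentations by `add V` and `D`. -/

/-- `M` is a direct sum of a module of `add V` and a module of `D`. -/
def HasDecomp (V : FGMod S) (D : Set (FGMod S)) (M : FGMod S) : Prop :=
  ∃ V' D' : FGMod S, V' ∈ addOf {V} ∧ D' ∈ D ∧
    Nonempty (M.carrier ≃ₗ[S] V'.carrier × D'.carrier)

/-- `M` is covered by a projective module with kernel a direct sum of a module of `add V`
and a module of `D`. -/
def HasCover (V : FGMod S) (D : Set (FGMod S)) (M : FGMod S) : Prop :=
  ∃ (P : FGMod S) (p : P.carrier →ₗ[S] M.carrier), P.IsProj ∧ Surjective p ∧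
    ∃ K : FGMod S, Nonempty (K.carrier ≃ₗ[S] LinearMap.ker p) ∧ HasDecomp V D K

theorem hasDecomp_of_mem_addOf {V : FGMod S} {D : Set (FGMod S)} (hD : D = addOf D)
    {M : FGMod S} (hM : M ∈ addOf {V}) : HasDecomp V D M :=
  ⟨M, ⟨PUnit.{u + 1}⟩, hM,
    hD ▸ mem_addOf_of_subsingleton D (inferInstanceAs (Subsingleton PUnit.{u + 1})),
    ⟨(LinearEquiv.prodUnique (M₂ := PUnit.{u + 1})).symm⟩⟩

theorem hasDecomp_of_mem {V : FGMod S} {D : Set (FGMod S)} {M : FGMod S} (hM : M ∈ D) :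
    HasDecomp V D M :=
  ⟨⟨PUnit.{u + 1}⟩, M,
    mem_addOf_of_subsingleton _ (inferInstanceAs (Subsingleton PUnit.{u + 1})), hM,
    ⟨(LinearEquiv.uniqueProd (M₂ := PUnit.{u + 1})).symm⟩⟩

theorem HasDecomp.prod [IsNoetherianRing S] {V : FGMod S} {D : Set (FGMod S)} (hD : D = addOf D)
    {W N N' : FGMod S} (e : W.carrier ≃ₗ[S] N.carrier × N'.carrier) (h : HasDecomp V D N)
    (h' : HasDecomp V D N') : HasDecomp V D W := by
  obtain ⟨V₁, D₁, hV, hD₁, ⟨e₁⟩⟩ := h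
  obtain ⟨V₂, D₂, hV', hD₂, ⟨e₂⟩⟩ := h'
  rw [hD] at hD₁ hD₂
  exact ⟨prodMod V₁ V₂, prodMod D₁ D₂, prodMod_mem_addOf hV hV',
    hD.symm ▸ prodMod_mem_addOf hD₁ hD₂,
    ⟨e.trans ((LinearEquiv.prodCongr e₁ e₂).trans (LinearEquiv.prodProdProdComm S _ _ _ _))⟩⟩

theorem HasCover.congr {V : FGMod S} {D : Set (FGMod S)} {M N : FGMod S}
    (e : M.carrier ≃ₗ[S] N.carrier) (h : HasCover V D M) : HasCover V D N := by
  obtain ⟨P, p, hP, hp, K, ⟨k⟩, hK⟩ := h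
  exact ⟨P, e.toLinearMap ∘ₗ p, hP, e.surjective.comp hp, K,
    ⟨k.trans (LinearEquiv.ofEq _ _ (LinearEquiv.ker_comp e p).symm)⟩, hK⟩

theorem hasCover_of_hasDecomp_syz [IsArtinianRing S] [IsNoetherianRing S] {V : FGMod S}
    {D : Set (FGMod S)} {M : FGMod S} (h : HasDecomp V D (syz M)) : HasCover V D M := by
  obtain ⟨P, f, hf, he⟩ := isSyzygyOf_syz M
  exact ⟨P, f, hf.1, hf.2.1, syz M, he, h⟩

theorem HasCover.prod [IsNoetherianRing S] {V : FGMod S} {D : Set (FGMod S)} (hD : D = addOf D)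
    {W N N' : FGMod S} (e : W.carrier ≃ₗ[S] N.carrier × N'.carrier) (h : HasCover V D N)
    (h' : HasCover V D N') : HasCover V D W := by
  obtain ⟨P, p, hP, hp, K, ⟨k⟩, hK⟩ := h
  obtain ⟨P', p', hP', hp', K', ⟨k'⟩, hK'⟩ := h'
  have : Module.Projective S P.carrier := hP
  have : Module.Projective S P'.carrier := hP'
  refine HasCover.congr (M := prodMod N N') e.symm ⟨prodMod P P', p.prodMap p',
    inferInstanceAs (Module.Projective S (P.carrier × P'.carrier)), hp.prodMap hp',
    prodMod K K', ⟨?_⟩, hK.prod hD (LinearEquiv.refl S _) hK'⟩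
  exact (LinearEquiv.prodCongr k k').trans
    { toFun := fun x => ⟨(x.1, x.2), Prod.ext x.1.2 x.2.2⟩
      invFun := fun x => (⟨x.1.1, congrArg Prod.fst x.2⟩, ⟨x.1.2, congrArg Prod.snd x.2⟩)
      map_add' := fun _ _ => rfl
      map_smul' := fun _ _ => rfl
      left_inv := fun _ => rfl
      right_inv := fun _ => rfl }

/-- An extension of a covered quotient by a decomposed submodule is presented by
`add V` and `D`. -/
theorem SES_of_hasCover_of_hasDecomp [IsNoetherianRing S] {V : FGMod S} {D : Set (FGMod S)}
    (hV : FGMod.regular S ∈ addOf {V}) {X : FGMod S} (Y : Submodule S X.carrier)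
    (hY : HasDecomp V D ⟨Y⟩) (hZ : HasCover V D ⟨X.carrier ⧸ Y⟩) :
    ∃ V1 V0 D1 D0 : FGMod S, V1 ∈ addOf {V} ∧ V0 ∈ addOf {V} ∧ D1 ∈ D ∧ D0 ∈ D ∧
      SES (prodMod V1 D1) (prodMod V0 D0) X := by
  obtain ⟨V', D', hV', hD', ⟨e⟩⟩ := hY
  obtain ⟨P, p, hP, hp, K, ⟨k⟩, V1, D1, hV1, hD1, ⟨e'⟩⟩ := hZ
  exact ⟨V1, prodMod P V', D1, D', hV1,
    prodMod_mem_addOf (mem_addOf_of_isProj hP hV) hV', hD1, hD',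
    SES_congr (SES_of_cover_quotient Y hP p hp) (k.symm.trans e')
      (((LinearEquiv.refl S P.carrier).prodCongr e).trans (LinearEquiv.prodAssoc S _ _ _).symm)⟩

/-!
STATEMENT 15 (Corollary).  Let `D` be a `0`-Igusa-Todorov subcategory.  If
`rad^{2n+1}(A) = 0` and the set of isomorphism classes of indecomposable
`A/radⁿ(A)`-modules not in `D` (inside `mod A`) is finite, then `A` is a `1`-LIT
algebra.  Powers of the radical are taken as `R`-submodules of the Artin algebra `A`.
-/
theorem stmt_15 (R A : Type u) [CommRing R] [IsArtinianRing R] [Ring A] [Algebra R A]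
    [Module.Finite R A]
    (L : AddMonoid.End (K0 Aᵐᵒᵖ)) (hL : IsSyzEnd L)
    (D : Set (FGMod Aᵐᵒᵖ)) (hD : IsZeroIT L D)
    (n : ℕ)
    (hrad : ((Ideal.jacobson (⊥ : Ideal A)).restrictScalars R) ^ (2 * n + 1) =
      (⊥ : Submodule R A))
    (hfin : FinUpToIso {M : FGMod Aᵐᵒᵖ |
      (∀ (m : M.carrier), ∀ x ∈ ((Ideal.jacobson (⊥ : Ideal A)).restrictScalars R) ^ n,
        MulOpposite.op x • m = 0) ∧ M ∉ D ∧ Indec M}) :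
    IsNLITAlgebra L 1 := by
  have : Module.Finite R Aᵐᵒᵖ := Module.Finite.equiv (MulOpposite.opLinearEquiv R (M := A))
  have : IsArtinianRing Aᵐᵒᵖ := isArtinian_of_tower R inferInstance
  have : IsNoetherianRing Aᵐᵒᵖ := isNoetherian_of_tower R inferInstance
  obtain ⟨k, f, hf⟩ := hfin
  have hDD := hD.1
  set J : Submodule R A := (Ideal.jacobson (⊥ : Ideal A)).restrictScalars R
  let C : Set (FGMod Aᵐᵒᵖ) :=
    {M | ∀ (m : M.carrier), ∀ x ∈ J ^ n, MulOpposite.op x • m = 0}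
  have hC : ∀ W N : FGMod Aᵐᵒᵖ, IsSummand N W → W ∈ C → N ∈ C := by
    intro W N hN hW m x hx
    obtain ⟨p, i, h⟩ := isSummand_iff_exists_split.mp hN
    have h' : p (i m) = m := LinearMap.congr_fun h m
    rw [← h', ← map_smul, hW (i m) x hx, map_zero]
  let V : FGMod Aᵐᵒᵖ :=
    prodMod (prodMod (dsum f) (dsum fun i => syz (f i))) (FGMod.regular Aᵐᵒᵖ)
  have hVmem : V ∈ addOf {V} := subset_addOf _ rfl
  have hreg : FGMod.regular Aᵐᵒᵖ ∈ addOf {V} :=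
    mem_addOf_of_isSummand (isSummand_prodMod_right _ _) hVmem
  have hfs := mem_addOf_of_isSummand (isSummand_prodMod_left _ _) hVmem
  have hfV : ∀ i, f i ∈ addOf {V} := fun i =>
    mem_addOf_of_isSummand (isSummand_trans (isSummand_dsum f i) (isSummand_prodMod_left _ _)) hfs
  have hsV : ∀ i, syz (f i) ∈ addOf {V} := fun i =>
    mem_addOf_of_isSummand (isSummand_trans (isSummand_dsum (fun i => syz (f i)) i)
      (isSummand_prodMod_right _ _)) hfs
  have hzero : ∀ W : FGMod Aᵐᵒᵖ, Subsingleton W.carrier → W ∈ D := fun W hW =>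
    hDD ▸ mem_addOf_of_subsingleton D hW
  have hdec : ∀ W ∈ C, HasDecomp V D W := by
    refine induction_on_indec C hC _ (fun W hW => hasDecomp_of_mem (hzero W hW))
      (fun W hW hi => ?_) fun W N N' ⟨e⟩ h h' => h.prod hDD e h'
    by_cases hWD : W ∈ D
    · exact hasDecomp_of_mem hWD
    · obtain ⟨i, ⟨e⟩⟩ := hf W ⟨hW, hWD, hi⟩
      exact hasDecomp_of_mem_addOf hDD (mem_addOf_of_equiv e.symm (hfV i))
  have hcov : ∀ W ∈ C, HasCover V D W := by
    have hcovD : ∀ W ∈ D, HasCover V D W := fun W hW =>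
      hasCover_of_hasDecomp_syz (hasDecomp_of_mem (hD.2.1 W hW))
    refine induction_on_indec C hC _ (fun W hW => hcovD W (hzero W hW))
      (fun W hW hi => ?_) fun W N N' ⟨e⟩ h h' => h.prod hDD e h'
    by_cases hWD : W ∈ D
    · exact hcovD W hWD
    · obtain ⟨i, ⟨e⟩⟩ := hf W ⟨hW, hWD, hi⟩
      exact (hasCover_of_hasDecomp_syz (hasDecomp_of_mem_addOf hDD (hsV i))).congr e.symm
  refine ⟨V, D, hD, fun M _ => ?_⟩
  simp only [Function.iterate_one]
  let Y : Submodule Aᵐᵒᵖ (syz M).carrier :=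
    { carrier := {y | ∀ (s : A), ∀ b ∈ J ^ n, MulOpposite.op b • MulOpposite.op s • y = 0}
      add_mem' := fun hx hy s b hb => by simp [smul_add, hx s b hb, hy s b hb]
      zero_mem' := fun s b _ => by simp
      smul_mem' := fun c y hy s b hb => by
        have h := hy (c.unop * s) b hb
        rwa [MulOpposite.op_mul, MulOpposite.op_unop, mul_smul] at h }
  refine SES_of_hasCover_of_hasDecomp hreg Y (hdec _ fun y b hb => Subtype.ext ?_)
    (hcov _ fun z a ha => ?_)
  · have h := y.2 1 b hb
    rwa [MulOpposite.op_one, one_smul Aᵐᵒᵖ] at h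
  · obtain ⟨x, rfl⟩ := Y.mkQ_surjective z
    refine (map_smul Y.mkQ _ x).symm.trans ((Submodule.Quotient.mk_eq_zero Y).mpr ?_)
    exact fun s b hb => smul_syz_eq_zero hrad M x s ha hb
end LIT
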